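/- Let U, V be nonlocal vertex algebras and R(x) a twisting operator for (U,V), and let K be a nonlocal vertex algebra containing U and V as subalgebras such that for all u ∈ U, v ∈ V: Y(u,x)v ∈ K[[x]] and Y(v,x)u = e^{xD} Y(−x) R(−x)(v⊗u). Assume K is generated as a nonlocal vertex algebra by U ∪ V, and that U, as a module over itself, is irreducible and of countable dimension over ℂ. Then the linear map θ: U⊗_R V → K defined by θ(u⊗v) = u_{-1}v is an isomorphism of nonlocal vertex algebras. -/

import Mathlib

open scoped TensorProduct BigOperators

noncomputable section

/-- Integer binomial coefficient `C(n, k)` for `n : ℤ`, `k : ℕ`. -/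
def zchoose (n : ℤ) (k : ℕ) : ℤ :=
  if 0 ≤ n then ((n.toNat).choose k : ℤ)
  else (-1) ^ k * ((((k : ℤ) - n - 1).toNat).choose k)

section Series

variable {V : Type*} [AddCommGroup V] [Module ℂ V]

/-- `a` is (the coefficient family of) an element of `V((x))`. -/
def IsLaurent (a : ℤ → V) : Prop := ∃ N : ℤ, ∀ n : ℤ, n < N → a n = 0

/-- `a` is an element of `V[[x]]`. -/
def IsPowerSeries (a : ℤ → V) : Prop := ∀ n : ℤ, n < 0 → a n = 0

/-- `A` is an element of `V((x₁, x₂))` (first index: exponent of `x₁`). -/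
def IsLaurent2 (A : ℤ → ℤ → V) : Prop :=
  ∃ N : ℤ, ∀ m n : ℤ, (m < N ∨ n < N) → A m n = 0

/-- `a` is an element of `V ⊗ ℂ((x)) ⊆ V((x))`: truncated below, with coefficients
lying in a finitely generated (i.e. finite dimensional) subspace. -/
def IsTensorLaurent (a : ℤ → V) : Prop :=
  IsLaurent a ∧ ∃ F : Submodule ℂ V, F.FG ∧ ∀ n, a n ∈ F

/-- Multiply the double series `A(x₁,x₂)` by `(x₁+x₂)^k`. -/
def mulAddPow (k : ℕ) (A : ℤ → ℤ → V) : ℤ → ℤ → V := fun a b =>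
  ∑ j ∈ Finset.range (k + 1), ((k.choose j : ℕ) : ℂ) • A (a - (k : ℤ) + j) (b - j)

/-- Multiply the double series `A(x₁,x₂)` by `(x₁-x₂)^k`. -/
def mulSubPow (k : ℕ) (A : ℤ → ℤ → V) : ℤ → ℤ → V := fun a b =>
  ∑ j ∈ Finset.range (k + 1),
    ((-1 : ℂ) ^ j * ((k.choose j : ℕ) : ℂ)) • A (a - (k : ℤ) + j) (b - j)

/-- Multiply the double series `A(x₁,x₂)` by `(x₂-x₁)^k`. -/
def mulSubPow' (k : ℕ) (A : ℤ → ℤ → V) : ℤ → ℤ → V := fun a b =>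
  ∑ j ∈ Finset.range (k + 1),
    ((-1 : ℂ) ^ j * ((k.choose j : ℕ) : ℂ)) • A (a - j) (b - (k : ℤ) + j)

/-- Substitute `x₁ = x₀ + x₂` in `A(x₁,x₂)`, expanding in nonnegative powers of `x₂`.
The result is indexed by (exponent of `x₀`, exponent of `x₂`). -/
def substAdd02 (A : ℤ → ℤ → V) : ℤ → ℤ → V := fun a b =>
  ∑ᶠ i : ℕ, ((zchoose (a + i) i : ℤ) : ℂ) • A (a + i) (b - i)

/-- Substitute `x₁ = x₂ + x₀` in `A(x₁,x₂)`, expanding in nonnegative powers of `x₀`.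
The result is indexed by (exponent of `x₀`, exponent of `x₂`). -/
def substAdd20 (A : ℤ → ℤ → V) : ℤ → ℤ → V := fun a b =>
  if 0 ≤ a then ∑ᶠ m : ℤ, ((zchoose m a.toNat : ℤ) : ℂ) • A m (b - m + a) else 0

/-- Multiply the double series `A(x₁,x₂)` by `f(x₂ - x₁)`, expanded in nonnegative
powers of `x₁`. -/
def scalarMulSub (f : ℤ → ℂ) (A : ℤ → ℤ → V) : ℤ → ℤ → V := fun m n =>
  ∑ᶠ (i : ℕ) (p : ℤ),
    ((-1 : ℂ) ^ i * ((zchoose p i : ℤ) : ℂ) * f p) • A (m - i) (n - p + i)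

/-- Multiply a double series by a polynomial in two variables. -/
def polyMul2 (p : MvPolynomial (Fin 2) ℂ) (A : ℤ → ℤ → V) : ℤ → ℤ → V := fun m n =>
  ∑ d ∈ p.support, MvPolynomial.coeff d p • A (m - (d 0 : ℤ)) (n - (d 1 : ℤ))

/-- The relation `A ∼ B`: `p·A = p·B` for some nonzero polynomial `p(x₁,x₂)`. -/
def SimEq2 (A B : ℤ → ℤ → V) : Prop :=
  ∃ p : MvPolynomial (Fin 2) ℂ, p ≠ 0 ∧ ∀ m n : ℤ, polyMul2 p A m n = polyMul2 p B m n

/-- `a` is an element of the iterated Laurent series space `V((x₁))⋯((x_n))`. -/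
def IsIterLaurent : (n : ℕ) → ((Fin n → ℤ) → V) → Prop
  | 0, _ => True
  | n + 1, a =>
      (∃ N : ℤ, ∀ k : Fin (n + 1) → ℤ, k (Fin.last n) < N → a k = 0) ∧
      ∀ m : ℤ, IsIterLaurent n fun k => a (Fin.snoc k m)

end Series

/-- A nonlocal vertex algebra over `ℂ`, with `Y u v n` the coefficient of `x^n`
in `Y(u,x)v` (so `u_m v = Y u v (-m-1)`). -/
structure NLVA (V : Type*) [AddCommGroup V] [Module ℂ V] where
  Y : V →ₗ[ℂ] V →ₗ[ℂ] (ℤ → V)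
  one : V
  trunc : ∀ u v : V, IsLaurent (Y u v)
  vacuum_left : ∀ (v : V) (n : ℤ), Y one v n = if n = 0 then v else 0
  creation_reg : ∀ v : V, IsPowerSeries (Y v one)
  creation_zero : ∀ v : V, Y v one 0 = v
  weak_assoc : ∀ u v w : V, ∃ k : ℕ, ∀ a b : ℤ,
    mulAddPow k (substAdd02 fun m n => Y u (Y v w n) m) a b
      = mulAddPow k (fun a' b' => Y (Y u v a') w b') a b

namespace NLVA

variable {U V K : Type*} [AddCommGroup U] [Module ℂ U] [AddCommGroup V] [Module ℂ V]
  [AddCommGroup K] [Module ℂ K]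

/-- The coefficient `Y(·)_n(·)` as a bilinear map. -/
def Yc (𝒱 : NLVA V) (n : ℤ) : V →ₗ[ℂ] V →ₗ[ℂ] V :=
  𝒱.Y.compr₂ (LinearMap.proj n)

/-- The operator `D(v) = v_{-2}𝟙`, i.e. the coefficient of `x^1` in `Y(v,x)𝟙`. -/
def D (𝒱 : NLVA V) : V →ₗ[ℂ] V :=
  (LinearMap.proj (1 : ℤ)).comp (𝒱.Y.flip 𝒱.one)

/-- Homomorphisms of nonlocal vertex algebras. -/
def IsHom (𝒰 : NLVA U) (𝒱 : NLVA V) (f : U →ₗ[ℂ] V) : Prop :=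
  f 𝒰.one = 𝒱.one ∧ ∀ (a b : U) (n : ℤ), f (𝒰.Y a b n) = 𝒱.Y (f a) (f b) n

/-- `𝒦` is generated, as a nonlocal vertex algebra, by the subset `S`. -/
def IsGeneratedBy (𝒦 : NLVA K) (S : Set K) : Prop :=
  ∀ P : Submodule ℂ K, 𝒦.one ∈ P →
    (∀ a ∈ P, ∀ b ∈ P, ∀ n : ℤ, 𝒦.Y a b n ∈ P) → S ⊆ P → P = ⊤

/-- `𝒰` is irreducible as a module over itself. -/
def SelfIrreducible (𝒰 : NLVA U) : Prop :=
  Nontrivial U ∧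
    ∀ P : Submodule ℂ U, (∀ u : U, ∀ p ∈ P, ∀ n : ℤ, 𝒰.Y u p n ∈ P) → P = ⊥ ∨ P = ⊤

/-- The coefficients of the product `Y(v₁,x₁)⋯Y(v_n,x_n)𝟙`. -/
def prodY (𝒱 : NLVA V) : (n : ℕ) → (Fin n → V) → (Fin n → ℤ) → V
  | 0, _, _ => 𝒱.one
  | n + 1, v, k => 𝒱.Y (v 0) (prodY 𝒱 n (fun i => v i.succ) fun i => k i.succ) (k 0)

/-- Non-degeneracy in the sense of Etingof–Kazhdan: the maps
`Z_n : V^{⊗n} ⊗ ℂ((x₁))⋯((x_n)) → V((x₁))⋯((x_n))` are injective. -/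
def NonDegenerate (𝒱 : NLVA V) : Prop :=
  ∀ n : ℕ, 0 < n → ∀ (r : ℕ) (v : Fin r → Fin n → V) (f : Fin r → (Fin n → ℤ) → ℂ),
    (∀ j, IsIterLaurent n (f j)) →
    LinearIndependent ℂ (fun j : Fin r => PiTensorProduct.tprod ℂ (v j)) →
    (∀ K' : Fin n → ℤ,
      (∑ j : Fin r, ∑ᶠ L : Fin n → ℤ,
        f j L • 𝒱.prodY n (v j) fun i => K' i - L i) = 0) →
    ∀ j, f j = 0

end NLVA

/-- Countable dimension over `ℂ`. -/
def CountableDim (U : Type*) [AddCommGroup U] [Module ℂ U] : Prop :=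
  ∃ s : Set U, s.Countable ∧ Submodule.span ℂ s = ⊤

/-- `𝒱` satisfies `𝒮`-locality, i.e. is a weak quantum vertex algebra. -/
def SLocal {V : Type*} [AddCommGroup V] [Module ℂ V] (𝒱 : NLVA V) : Prop :=
  ∀ u v : V, ∃ (r : ℕ) (uu vv : Fin r → V) (f : Fin r → ℤ → ℂ) (k : ℕ),
    (∀ i, IsLaurent (f i)) ∧ ∀ (w : V) (m n : ℤ),
      mulSubPow k (fun a b => 𝒱.Y u (𝒱.Y v w b) a) m n
        = mulSubPow k (fun a b => ∑ i, scalarMulSub (f i)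
            (fun a' b' => 𝒱.Y (vv i) (𝒱.Y (uu i) w a') b') a b) m n

/-- A module for a nonlocal vertex algebra. -/
structure NLVAModule {V : Type*} [AddCommGroup V] [Module ℂ V] (𝒱 : NLVA V)
    (W : Type*) [AddCommGroup W] [Module ℂ W] where
  Yw : V →ₗ[ℂ] W →ₗ[ℂ] (ℤ → W)
  trunc : ∀ (v : V) (w : W), IsLaurent (Yw v w)
  vacuum : ∀ (w : W) (n : ℤ), Yw 𝒱.one w n = if n = 0 then w else 0
  weak_assoc : ∀ (u v : V) (w : W), ∃ k : ℕ, ∀ a b : ℤ,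
    mulAddPow k (substAdd02 fun m n => Yw u (Yw v w n) m) a b
      = mulAddPow k (fun a' b' => Yw (𝒱.Y u v a') w b') a b

section Twist

variable {U V : Type*} [AddCommGroup U] [Module ℂ U] [AddCommGroup V] [Module ℂ V]

/-- Coefficient of `x₁^m x₂^n` in `(Y(x₂)⊗1)R²³(x₁)R¹²(x₁+x₂)` applied to `v ⊗ u ⊗ u'`. -/
def hex1RHS (𝒰 : NLVA U) (Rc : ℤ → (V ⊗[ℂ] U →ₗ[ℂ] U ⊗[ℂ] V))
    (v : V) (u u' : U) (m n : ℤ) : U ⊗[ℂ] V :=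
  ∑ᶠ (i : ℕ) (c : ℤ),
    ((zchoose (m - c + i) i : ℤ) : ℂ) •
      (TensorProduct.map (TensorProduct.lift (𝒰.Yc (n - i))) LinearMap.id)
        ((TensorProduct.assoc ℂ U U V).symm
          ((LinearMap.lTensor U (Rc c))
            ((TensorProduct.assoc ℂ U V U)
              ((Rc (m - c + i) (v ⊗ₜ u)) ⊗ₜ u'))))

/-- Coefficient of `x₁^m x₂^n` in `(1⊗Y(x₂))R¹²(x₁-x₂)R²³(x₁)` applied to `v ⊗ v' ⊗ u`. -/
def hex2RHS (𝒱 : NLVA V) (Rc : ℤ → (V ⊗[ℂ] U →ₗ[ℂ] U ⊗[ℂ] V))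
    (v v' : V) (u : U) (m n : ℤ) : U ⊗[ℂ] V :=
  ∑ᶠ (i : ℕ) (c : ℤ),
    ((-1 : ℂ) ^ i * ((zchoose (m - c + i) i : ℤ) : ℂ)) •
      (LinearMap.lTensor U (TensorProduct.lift (𝒱.Yc (n - i))))
        ((TensorProduct.assoc ℂ U V V)
          ((TensorProduct.map (Rc (m - c + i)) LinearMap.id)
            ((TensorProduct.assoc ℂ V U V).symm
              (v ⊗ₜ (Rc c (v' ⊗ₜ u))))))

/-- A twisting operator `R(x) : V ⊗ U → U ⊗ V ⊗ ℂ((x))` for the ordered pair `(U,V)`,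
given by its family of coefficients `Rc n`. -/
structure TwistingOp (𝒰 : NLVA U) (𝒱 : NLVA V) where
  Rc : ℤ → (V ⊗[ℂ] U →ₗ[ℂ] U ⊗[ℂ] V)
  laurent : ∀ t : V ⊗[ℂ] U, IsTensorLaurent fun n => Rc n t
  vac_right : ∀ (v : V) (n : ℤ),
    Rc n (v ⊗ₜ 𝒰.one) = if n = 0 then 𝒰.one ⊗ₜ v else 0
  vac_left : ∀ (u : U) (n : ℤ),
    Rc n (𝒱.one ⊗ₜ u) = if n = 0 then u ⊗ₜ 𝒱.one else 0
  hex1 : ∀ (v : V) (u u' : U) (m n : ℤ),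
    Rc m (v ⊗ₜ (𝒰.Y u u' n)) = hex1RHS 𝒰 Rc v u u' m n
  hex2 : ∀ (v v' : V) (u : U) (m n : ℤ),
    Rc m ((𝒱.Y v v' n) ⊗ₜ u) = hex2RHS 𝒱 Rc v v' u m n

/-- `Sc` is a two-sided inverse of `Rc` as `ℂ((x))`-linear maps (coefficientwise
convolution), with values in the tensor with `ℂ((x))`. -/
def IsInvPair {A B : Type*} [AddCommGroup A] [Module ℂ A] [AddCommGroup B] [Module ℂ B]
    (Rc : ℤ → (A →ₗ[ℂ] B)) (Sc : ℤ → (B →ₗ[ℂ] A)) : Prop :=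
  (∀ t : B, IsTensorLaurent fun n => Sc n t) ∧
  (∀ (t : A) (n : ℤ), (∑ᶠ c : ℤ, Sc c (Rc (n - c) t)) = if n = 0 then t else 0) ∧
  (∀ (t : B) (n : ℤ), (∑ᶠ c : ℤ, Rc c (Sc (n - c) t)) = if n = 0 then t else 0)

/-- The canonical embedding `u ↦ u ⊗ 𝟙`. -/
def iotaU (𝒱 : NLVA V) : U →ₗ[ℂ] U ⊗[ℂ] V := (TensorProduct.mk ℂ U V).flip 𝒱.one

/-- The canonical embedding `v ↦ 𝟙 ⊗ v`. -/
def iotaV (𝒰 : NLVA U) : V →ₗ[ℂ] U ⊗[ℂ] V := TensorProduct.mk ℂ U V 𝒰.one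

/-- The operator `D ⊗ 1 + 1 ⊗ D` on `U ⊗ V`. -/
def DUV (𝒰 : NLVA U) (𝒱 : NLVA V) : U ⊗[ℂ] V →ₗ[ℂ] U ⊗[ℂ] V :=
  LinearMap.rTensor V 𝒰.D + LinearMap.lTensor U 𝒱.D

/-- The coefficient of `x^n` in `Y_R(u⊗v, x)(u'⊗v') = (Y(x)⊗Y(x))R²³(-x)(u⊗v⊗u'⊗v')`. -/
def YRcoef (𝒰 : NLVA U) (𝒱 : NLVA V) (Rop : TwistingOp 𝒰 𝒱)
    (u : U) (v : V) (u' : U) (v' : V) (n : ℤ) : U ⊗[ℂ] V :=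
  ∑ᶠ (c : ℤ) (a : ℤ),
    ((-1 : ℂ) ^ c) •
      (TensorProduct.map (𝒰.Yc a u) ((𝒱.Yc (n - c - a)).flip v'))
        (Rop.Rc c (v ⊗ₜ u'))

/-- `𝒯` is the twisted tensor product nonlocal vertex algebra `U ⊗_R V`. -/
def IsTwistedTensor (𝒰 : NLVA U) (𝒱 : NLVA V) (Rop : TwistingOp 𝒰 𝒱)
    (𝒯 : NLVA (U ⊗[ℂ] V)) : Prop :=
  𝒯.one = 𝒰.one ⊗ₜ 𝒱.one ∧
  ∀ (u u' : U) (v v' : V) (n : ℤ),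
    𝒯.Y (u ⊗ₜ v) (u' ⊗ₜ v') n = YRcoef 𝒰 𝒱 Rop u v u' v' n

end Twist

section Aux

variable {A B W T : Type*} [AddCommGroup A] [Module ℂ A] [AddCommGroup B] [Module ℂ B]
  [AddCommGroup W] [Module ℂ W] [AddCommGroup T] [Module ℂ T]

/-- The linear map `(a ⊗ b) ↦ Y_A(a)_e (Y_B(b)_j w)`, i.e. the coefficient
of `Y_A(x₂)(1 ⊗ Y_B(x₁)) (· ⊗ · ⊗ w)` at `x₂^e x₁^j`. -/
def sandwichMod (YA : A →ₗ[ℂ] W →ₗ[ℂ] (ℤ → W)) (YB : B →ₗ[ℂ] W →ₗ[ℂ] (ℤ → W))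
    (w : W) (e j : ℤ) : A ⊗[ℂ] B →ₗ[ℂ] W :=
  TensorProduct.lift
    ((YA.compr₂ (LinearMap.proj e)).compl₂ ((YB.compr₂ (LinearMap.proj j)).flip w))

/-- Coefficient of `x₁^m x₂^n` in `Y_A(x₂)(1 ⊗ Y_B(x₁)) q(x₂ - x₁) (⋯ ⊗ w)`, where the
series `q` is evaluated at `x₂ - x₁`, expanded in nonnegative powers of `x₁`. -/
def twistRHS (YA : A →ₗ[ℂ] W →ₗ[ℂ] (ℤ → W)) (YB : B →ₗ[ℂ] W →ₗ[ℂ] (ℤ → W))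
    (q : ℤ → A ⊗[ℂ] B) (w : W) : ℤ → ℤ → W := fun m n =>
  ∑ᶠ (i : ℕ) (p : ℤ),
    ((-1 : ℂ) ^ i * ((zchoose p i : ℤ) : ℂ)) •
      sandwichMod YA YB w (n - p + i) (m - i) (q p)

/-- As `twistRHS`, but with `q` evaluated at `-x₂ + x₁`, expanded in nonnegative
powers of `x₂`. -/
def twistRHSalt (YA : A →ₗ[ℂ] W →ₗ[ℂ] (ℤ → W)) (YB : B →ₗ[ℂ] W →ₗ[ℂ] (ℤ → W))
    (q : ℤ → A ⊗[ℂ] B) (w : W) : ℤ → ℤ → W := fun m n =>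
  ∑ᶠ (i : ℕ) (p : ℤ),
    ((-1 : ℂ) ^ i * ((zchoose p i : ℤ) : ℂ)) •
      sandwichMod YA YB w (n - i) (m - p + i) (q p)

/-- Coefficient of `x^n` in `e^{xD} F(x)` where `F` is given by its coefficients. -/
def expD (Dop : T →ₗ[ℂ] T) (F : ℤ → T) (n : ℤ) : T :=
  ∑ᶠ j : ℕ, ((j.factorial : ℂ))⁻¹ • (Dop ^ j) (F (n - j))

end Aux

section YBE

variable {V : Type*} [AddCommGroup V] [Module ℂ V]

/-- The flip of the last two tensor factors of `(V⊗V)⊗V`. -/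
def swap23 : (V ⊗[ℂ] V) ⊗[ℂ] V →ₗ[ℂ] (V ⊗[ℂ] V) ⊗[ℂ] V :=
  ((TensorProduct.assoc ℂ V V V).symm.toLinearMap).comp
    ((LinearMap.lTensor V (TensorProduct.comm ℂ V V).toLinearMap).comp
      (TensorProduct.assoc ℂ V V V).toLinearMap)

/-- `S¹²` acting on `(V⊗V)⊗V`. -/
def S12m (Sc : ℤ → (V ⊗[ℂ] V →ₗ[ℂ] V ⊗[ℂ] V)) (c : ℤ) :
    (V ⊗[ℂ] V) ⊗[ℂ] V →ₗ[ℂ] (V ⊗[ℂ] V) ⊗[ℂ] V :=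
  TensorProduct.map (Sc c) LinearMap.id

/-- `S²³` acting on `(V⊗V)⊗V`. -/
def S23m (Sc : ℤ → (V ⊗[ℂ] V →ₗ[ℂ] V ⊗[ℂ] V)) (c : ℤ) :
    (V ⊗[ℂ] V) ⊗[ℂ] V →ₗ[ℂ] (V ⊗[ℂ] V) ⊗[ℂ] V :=
  ((TensorProduct.assoc ℂ V V V).symm.toLinearMap).comp
    ((LinearMap.lTensor V (Sc c)).comp (TensorProduct.assoc ℂ V V V).toLinearMap)

/-- `S¹³` acting on `(V⊗V)⊗V`. -/
def S13m (Sc : ℤ → (V ⊗[ℂ] V →ₗ[ℂ] V ⊗[ℂ] V)) (c : ℤ) :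
    (V ⊗[ℂ] V) ⊗[ℂ] V →ₗ[ℂ] (V ⊗[ℂ] V) ⊗[ℂ] V :=
  swap23.comp ((S12m Sc c).comp swap23)

/-- `S²¹(x) = σ S(x) σ`. -/
def S21c (Sc : ℤ → (V ⊗[ℂ] V →ₗ[ℂ] V ⊗[ℂ] V)) (c : ℤ) :
    V ⊗[ℂ] V →ₗ[ℂ] V ⊗[ℂ] V :=
  ((TensorProduct.comm ℂ V V).toLinearMap).comp
    ((Sc c).comp (TensorProduct.comm ℂ V V).toLinearMap)

/-- The quantum Yang–Baxter equation
`S¹²(x)S¹³(x+z)S²³(z) = S²³(z)S¹³(x+z)S¹²(x)` (coefficient of `x^a z^b`, with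
`S¹³(x+z)` expanded in nonnegative powers of `z`). -/
def QYBE (Sc : ℤ → (V ⊗[ℂ] V →ₗ[ℂ] V ⊗[ℂ] V)) : Prop :=
  ∀ (t : (V ⊗[ℂ] V) ⊗[ℂ] V) (a b : ℤ),
    (∑ᶠ (i : ℕ) (p : ℤ), ((zchoose p i : ℤ) : ℂ) •
        S12m Sc (a - p + i) (S13m Sc p (S23m Sc (b - i) t)))
      = ∑ᶠ (i : ℕ) (p : ℤ), ((zchoose p i : ℤ) : ℂ) •
          S23m Sc (b - i) (S13m Sc p (S12m Sc (a - p + i) t))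

/-- Unitarity: `S(x) S²¹(-x) = 1`. -/
def Unitary (Sc : ℤ → (V ⊗[ℂ] V →ₗ[ℂ] V ⊗[ℂ] V)) : Prop :=
  ∀ (t : V ⊗[ℂ] V) (n : ℤ),
    (∑ᶠ c : ℤ, ((-1 : ℂ) ^ (n - c)) • Sc c (S21c Sc (n - c) t))
      = if n = 0 then t else 0

/-- `[D ⊗ 1, S(x)] = -(d/dx) S(x)`. -/
def DComm1 (𝒱 : NLVA V) (Sc : ℤ → (V ⊗[ℂ] V →ₗ[ℂ] V ⊗[ℂ] V)) : Prop :=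
  ∀ (t : V ⊗[ℂ] V) (n : ℤ),
    (LinearMap.rTensor V 𝒱.D) (Sc n t) - Sc n ((LinearMap.rTensor V 𝒱.D) t)
      = (-((n : ℂ) + 1)) • Sc (n + 1) t

/-- `Y(u,x)v = e^{xD} Y(-x) S(-x)(v⊗u)`. -/
def SkewS (𝒱 : NLVA V) (Sc : ℤ → (V ⊗[ℂ] V →ₗ[ℂ] V ⊗[ℂ] V)) : Prop :=
  ∀ (u v : V) (n : ℤ),
    𝒱.Y u v n = expD 𝒱.D (fun p => ((-1 : ℂ) ^ p) •
      ∑ᶠ c : ℤ, (TensorProduct.lift (𝒱.Yc (p - c))) (Sc c (v ⊗ₜ u))) n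

/-- `S(x₁)(Y(x₂)⊗1) = (Y(x₂)⊗1)S²³(x₁)S¹³(x₁+x₂)`. -/
def HexY1 (𝒱 : NLVA V) (Sc : ℤ → (V ⊗[ℂ] V →ₗ[ℂ] V ⊗[ℂ] V)) : Prop :=
  ∀ (t : (V ⊗[ℂ] V) ⊗[ℂ] V) (m n : ℤ),
    Sc m ((TensorProduct.map (TensorProduct.lift (𝒱.Yc n)) LinearMap.id) t)
      = ∑ᶠ (i : ℕ) (p : ℤ), ((zchoose p i : ℤ) : ℂ) •
          (TensorProduct.map (TensorProduct.lift (𝒱.Yc (n - i))) LinearMap.id)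
            (S23m Sc (m - p + i) (S13m Sc p t))

/-- `S(x₁)(1⊗Y(x₂)) = (1⊗Y(x₂))S¹²(x₁-x₂)S¹³(x₁)`. -/
def HexY2 (𝒱 : NLVA V) (Sc : ℤ → (V ⊗[ℂ] V →ₗ[ℂ] V ⊗[ℂ] V)) : Prop :=
  ∀ (t : (V ⊗[ℂ] V) ⊗[ℂ] V) (m n : ℤ),
    Sc m ((LinearMap.lTensor V (TensorProduct.lift (𝒱.Yc n)))
        ((TensorProduct.assoc ℂ V V V) t))
      = ∑ᶠ (i : ℕ) (p : ℤ), ((-1 : ℂ) ^ i * ((zchoose p i : ℤ) : ℂ)) •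
          (LinearMap.lTensor V (TensorProduct.lift (𝒱.Yc (n - i))))
            ((TensorProduct.assoc ℂ V V V)
              (S12m Sc p (S13m Sc (m - p + i) t)))

/-- A quantum vertex algebra `(V, 𝒮)`. -/
structure QVA (V : Type*) [AddCommGroup V] [Module ℂ V] where
  alg : NLVA V
  sloc : SLocal alg
  Sc : ℤ → (V ⊗[ℂ] V →ₗ[ℂ] V ⊗[ℂ] V)
  laurent : ∀ t : V ⊗[ℂ] V, IsTensorLaurent fun n => Sc n t
  qybe : QYBE Sc
  unitary : Unitary Sc
  vac : ∀ (v : V) (n : ℤ), Sc n (alg.one ⊗ₜ v) = if n = 0 then alg.one ⊗ₜ v else 0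
  dcomm : DComm1 alg Sc
  skew : SkewS alg Sc
  hex : HexY1 alg Sc

end YBE

section Bialg

variable {H : Type*} [AddCommGroup H] [Module ℂ H]

/-- A nonlocal vertex bialgebra. -/
structure NLVBialg (H : Type*) [AddCommGroup H] [Module ℂ H] where
  alg : NLVA H
  comul : H →ₗ[ℂ] H ⊗[ℂ] H
  counit : H →ₗ[ℂ] ℂ
  coassoc : ∀ h : H, (LinearMap.lTensor H comul) (comul h)
      = (TensorProduct.assoc ℂ H H H) ((LinearMap.rTensor H comul) (comul h))
  counit_comul_left : ∀ h : H,
      (TensorProduct.lid ℂ H) ((LinearMap.rTensor H counit) (comul h)) = h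
  counit_comul_right : ∀ h : H,
      (TensorProduct.rid ℂ H) ((LinearMap.lTensor H counit) (comul h)) = h
  counit_one : counit alg.one = 1
  counit_mul : ∀ (a b : H) (n : ℤ),
      counit (alg.Y a b n) = if n = 0 then counit a * counit b else 0
  comul_one : comul alg.one = alg.one ⊗ₜ alg.one
  comul_mul : ∀ (a b : H) (n : ℤ),
      comul (alg.Y a b n)
        = ∑ᶠ p : ℤ, (TensorProduct.map₂ (alg.Yc p) (alg.Yc (n - p))) (comul a) (comul b)

/-- A nonlocal vertex `H`-module-algebra. -/
structure NLVModAlg (𝓗 : NLVBialg H) (U : Type*) [AddCommGroup U] [Module ℂ U] where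
  alg : NLVA U
  act : NLVAModule 𝓗.alg U
  scalar : ∀ (h : H) (u : U), IsTensorLaurent fun n => act.Yw h u n
  vac : ∀ (h : H) (n : ℤ),
      act.Yw h alg.one n = if n = 0 then 𝓗.counit h • alg.one else 0
  compat : ∀ (h : H) (u v : U) (m n : ℤ),
      act.Yw h (alg.Y u v n) m
        = ∑ᶠ (i : ℕ) (p : ℤ), ((-1 : ℂ) ^ i * ((zchoose p i : ℤ) : ℂ)) •
            (TensorProduct.lift
              (((alg.Yc (n - i)).comp ((act.Yw.compr₂ (LinearMap.proj p)).flip u)).compl₂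
                ((act.Yw.compr₂ (LinearMap.proj (m - p + i))).flip v)))
            (𝓗.comul h)

/-- A nonlocal vertex `H`-comodule-algebra. -/
structure NLVComodAlg (𝓗 : NLVBialg H) (V : Type*) [AddCommGroup V] [Module ℂ V] where
  alg : NLVA V
  rho : V →ₗ[ℂ] H ⊗[ℂ] V
  coassoc : ∀ v : V, (LinearMap.lTensor H rho) (rho v)
      = (TensorProduct.assoc ℂ H H V) ((LinearMap.rTensor V 𝓗.comul) (rho v))
  counit_rho : ∀ v : V,
      (TensorProduct.lid ℂ V) ((LinearMap.rTensor V 𝓗.counit) (rho v)) = v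
  rho_one : rho alg.one = 𝓗.alg.one ⊗ₜ alg.one
  rho_mul : ∀ (v v' : V) (n : ℤ),
      rho (alg.Y v v' n)
        = ∑ᶠ p : ℤ, (TensorProduct.map₂ (𝓗.alg.Yc p) (alg.Yc (n - p))) (rho v) (rho v')

/-- The coefficient of `x^n` in
`Y_♯(u⊗v, x)(u'⊗v') = Y(u,x)Y(b¹(v),x)u' ⊗ Y(v²,x)v'`. -/
def Ysharp (𝓗 : NLVBialg H) {U V : Type*} [AddCommGroup U] [Module ℂ U]
    [AddCommGroup V] [Module ℂ V] (MU : NLVModAlg 𝓗 U) (CV : NLVComodAlg 𝓗 V)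
    (u : U) (v : V) (u' : U) (v' : V) (n : ℤ) : U ⊗[ℂ] V :=
  ∑ᶠ (a : ℤ) (p : ℤ),
    (TensorProduct.map
      ((MU.alg.Yc a u).comp ((MU.act.Yw.compr₂ (LinearMap.proj p)).flip u'))
      ((CV.alg.Yc (n - a - p)).flip v'))
    (CV.rho v)

/-- Rearrangement `(H⊗V)⊗U → (H⊗U)⊗V`. -/
def smashSwap {U V : Type*} [AddCommGroup U] [Module ℂ U]
    [AddCommGroup V] [Module ℂ V] :
    (H ⊗[ℂ] V) ⊗[ℂ] U →ₗ[ℂ] (H ⊗[ℂ] U) ⊗[ℂ] V :=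
  ((TensorProduct.assoc ℂ H U V).symm.toLinearMap).comp
    ((LinearMap.lTensor H (TensorProduct.comm ℂ V U).toLinearMap).comp
      (TensorProduct.assoc ℂ H V U).toLinearMap)

/-- The coefficient of `x^n` in `R(x)(v⊗u) = Y(b¹(v),-x)u ⊗ v²`. -/
def Rsmash (𝓗 : NLVBialg H) {U V : Type*} [AddCommGroup U] [Module ℂ U]
    [AddCommGroup V] [Module ℂ V] (MU : NLVModAlg 𝓗 U) (CV : NLVComodAlg 𝓗 V)
    (n : ℤ) : V ⊗[ℂ] U →ₗ[ℂ] U ⊗[ℂ] V :=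
  ((-1 : ℂ) ^ n) •
    ((TensorProduct.map
        (TensorProduct.lift (MU.act.Yw.compr₂ (LinearMap.proj n))) LinearMap.id).comp
      (smashSwap.comp (LinearMap.rTensor U CV.rho)))

end Bialg

section FormalCalculus

theorem zchoose_eq_choose (n : ℤ) (k : ℕ) : zchoose n k = Ring.choose n k := by
  unfold zchoose
  split_ifs with h
  · lift n to ℕ using h
    simp [Ring.choose_natCast]
  · obtain ⟨m, rfl⟩ : ∃ m : ℕ, n = -(m : ℤ) := ⟨(-n).toNat, by omega⟩
    have h1 : ((k : ℤ) - -(m : ℤ) - 1).toNat = m + k - 1 := by omega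
    have h2 : ((m : ℤ) + k - 1) = ((m + k - 1 : ℕ) : ℤ) := by omega
    rw [h1, Ring.choose_neg, h2, Ring.choose_natCast]
    simp [Units.smul_def, Int.coe_negOnePow_natCast]

/-- The binomial coefficient `C(n, l)` with integer arguments, zero for `l < 0`. -/
def intChoose (n l : ℤ) : ℂ := if 0 ≤ l then ((zchoose n l.toNat : ℤ) : ℂ) else 0

theorem intChoose_natCast (n : ℤ) (k : ℕ) : intChoose n k = ((zchoose n k : ℤ) : ℂ) := by
  simp [intChoose]

theorem intChoose_of_neg (n : ℤ) {l : ℤ} (h : l < 0) : intChoose n l = 0 := by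
  simp [intChoose, h]

@[simp]
theorem intChoose_zero (n : ℤ) : intChoose n 0 = 1 := by
  simp [intChoose, zchoose_eq_choose]

theorem intChoose_one (n : ℤ) : intChoose n 1 = n := by
  simp [intChoose, zchoose_eq_choose]

theorem intChoose_nat_nat (n k : ℕ) : intChoose n k = (n.choose k : ℂ) := by
  simp [intChoose, zchoose_eq_choose, Ring.choose_natCast]

theorem intChoose_of_lt {n l : ℤ} (hn : 0 ≤ n) (h : n < l) : intChoose n l = 0 := by
  lift n to ℕ using hn
  lift l to ℕ using by omega
  rw [intChoose_nat_nat, Nat.choose_eq_zero_of_lt (by omega), Nat.cast_zero]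

theorem intChoose_symm {n : ℤ} (hn : 0 ≤ n) (l : ℤ) : intChoose n (n - l) = intChoose n l := by
  rcases lt_or_ge l 0 with h | h
  · rw [intChoose_of_neg n h, intChoose_of_lt hn (by omega)]
  rcases lt_or_ge n l with h' | h'
  · rw [intChoose_of_lt hn h', intChoose_of_neg n (by omega)]
  lift n to ℕ using hn
  lift l to ℕ using h
  rw [← Int.ofNat_sub (by omega), intChoose_nat_nat, intChoose_nat_nat, Nat.choose_symm (by omega)]

theorem intChoose_succ (n l : ℤ) : intChoose (n + 1) l = intChoose n l + intChoose n (l - 1) := by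
  rcases lt_trichotomy l 0 with h | rfl | h
  · simp [intChoose_of_neg _ h, intChoose_of_neg n (show l - 1 < 0 by omega)]
  · simp [intChoose_of_neg]
  · obtain ⟨k, rfl⟩ : ∃ k : ℕ, l = ((k + 1 : ℕ) : ℤ) := ⟨(l - 1).toNat, by omega⟩
    have : (((k + 1 : ℕ) : ℤ) - 1) = (k : ℤ) := by push_cast; ring
    rw [this]
    simp only [intChoose_natCast, zchoose_eq_choose, Ring.choose_succ_succ]
    push_cast
    ring

theorem intChoose_mul_sub (n : ℤ) (j : ℕ) :
    (j + 1 : ℂ) * intChoose n (j + 1) = (n - j) * intChoose n j := by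
  have h := Ring.choose_smul_choose n (Nat.le_succ j)
  simp only [Nat.succ_eq_add_one, Nat.choose_succ_self_right, Nat.add_sub_cancel_left,
    Ring.choose_one_right, nsmul_eq_mul] at h
  have h' := congrArg (fun z : ℤ => (z : ℂ)) h
  push_cast at h'
  have e : ((j : ℤ) + 1) = ((j + 1 : ℕ) : ℤ) := by push_cast; ring
  rw [e, intChoose_natCast, intChoose_natCast, zchoose_eq_choose, zchoose_eq_choose, h']
  ring

theorem finsum_eq_sum_Icc {M : Type*} [AddCommMonoid M] (f : ℤ → M) (lo hi : ℤ) (h₁ : ∀ m, m < lo → f m = 0)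
    (h₂ : ∀ m, hi < m → f m = 0) : ∑ᶠ m, f m = ∑ m ∈ Finset.Icc lo hi, f m := by
  refine finsum_eq_sum_of_support_subset _ fun m hm => ?_
  rw [Finset.coe_Icc, Set.mem_Icc]
  by_contra h
  rw [not_and_or, not_le, not_le] at h
  exact hm (h.elim (h₁ m) (h₂ m))

theorem finsum_nat_eq_finsum_int {M : Type*} [AddCommMonoid M] (a : ℤ) (f : ℤ → M) (h : ∀ m, m < a → f m = 0) :
    ∑ᶠ i : ℕ, f (a + i) = ∑ᶠ m : ℤ, f m := by
  have hinj : Function.Injective fun i : ℕ => a + (i : ℤ) := fun i j hij => by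
    simpa using hij
  rw [← finsum_mem_range (f := f) hinj, ← finsum_mem_univ f]
  exact finsum_mem_inter_support_eq' f _ _ fun m hm => ⟨fun _ => trivial, fun _ =>
    ⟨(m - a).toNat, by have := mt (h m) hm; simp only; omega⟩⟩

section Series

variable {W : Type*} [AddCommGroup W] [Module ℂ W]

theorem sum_choose_succ_smul (k : ℕ) (f : ℕ → W) :
    ∑ j ∈ Finset.range (k + 1 + 1), (((k + 1).choose j : ℕ) : ℂ) • f j
      = ∑ j ∈ Finset.range (k + 1), ((k.choose j : ℕ) : ℂ) • f j
        + ∑ j ∈ Finset.range (k + 1), ((k.choose j : ℕ) : ℂ) • f (j + 1) := by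
  rw [Finset.sum_range_succ']
  simp only [Nat.choose_succ_succ, Nat.cast_add, add_smul, Finset.sum_add_distrib]
  rw [Finset.sum_range_succ (fun j => ((k.choose (j + 1) : ℕ) : ℂ) • f (j + 1)),
    Finset.sum_range_succ' (fun j => ((k.choose j : ℕ) : ℂ) • f j)]
  simp
  abel

theorem sum_choose_mul_intChoose_sub (k : ℕ) (n l : ℤ) :
    ∑ j ∈ Finset.range (k + 1), ((k.choose j : ℕ) : ℂ) * intChoose n (l - j)
      = intChoose (n + k) l := by
  induction k generalizing l with
  | zero => simp
  | succ k ih =>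
    have h := sum_choose_succ_smul k fun j => intChoose n (l - j)
    simp only [smul_eq_mul] at h
    have e : ∀ j : ℕ, l - ((j + 1 : ℕ) : ℤ) = l - 1 - j := fun j => by push_cast; ring
    simp only [e] at h
    rw [h, ih, ih, Nat.cast_succ, ← add_assoc, intChoose_succ]

theorem sum_choose_mul_intChoose_add (k : ℕ) (n l : ℤ) :
    ∑ j ∈ Finset.range (k + 1), ((k.choose j : ℕ) : ℂ) * intChoose n (l - k + j)
      = intChoose (n + k) l := by
  rw [← sum_choose_mul_intChoose_sub, ← Finset.sum_range_reflect]
  refine Finset.sum_congr rfl fun j hj => ?_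
  have hj' : j ≤ k := Nat.lt_succ_iff.1 (Finset.mem_range.1 hj)
  rw [show k + 1 - 1 - j = k - j by omega, Nat.choose_symm hj', Nat.cast_sub hj']
  congr 2
  ring

theorem sum_neg_one_zpow_mul_intChoose (m : ℕ) {c lo hi : ℤ} (h₁ : lo ≤ c) (h₂ : c + m ≤ hi) :
    ∑ p ∈ Finset.Icc lo hi, (-1 : ℂ) ^ p * intChoose m (p - c)
      = if m = 0 then (-1 : ℂ) ^ c else 0 := by
  rcases m with _ | m
  · rw [Finset.sum_eq_single c]
    · simp
    · intro p _ hp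
      rcases lt_or_gt_of_ne hp with h | h
      · rw [intChoose_of_neg _ (by omega), mul_zero]
      · rw [intChoose_of_lt (by simp) (by push_cast; omega), mul_zero]
    · intro h
      exact absurd (Finset.mem_Icc.2 ⟨h₁, by simpa using h₂⟩) h
  · have tele : ∀ k : ℕ, ∑ p ∈ Finset.Icc lo (lo + k), (-1 : ℂ) ^ p * intChoose (m + 1 : ℕ) (p - c)
        = (-1 : ℂ) ^ (lo + k) * intChoose m (lo + k - c) := by
      intro k
      induction k with
      | zero =>
        simp only [Nat.cast_zero, add_zero, Finset.Icc_self, Finset.sum_singleton]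
        rw [Nat.cast_succ, intChoose_succ, intChoose_of_neg _ (show lo - c - 1 < 0 by omega),
          add_zero]
      | succ k ih =>
        have e : Finset.Icc lo (lo + ((k + 1 : ℕ) : ℤ))
            = insert (lo + ((k + 1 : ℕ) : ℤ)) (Finset.Icc lo (lo + k)) := by
          ext x
          simp only [Finset.mem_insert, Finset.mem_Icc]
          push_cast
          omega
        rw [e, Finset.sum_insert (by simp), ih, Nat.cast_succ m, intChoose_succ]
        have e₂ : lo + ((k + 1 : ℕ) : ℤ) - c - 1 = lo + k - c := by push_cast; ring
        have e₃ : (-1 : ℂ) ^ (lo + ((k + 1 : ℕ) : ℤ)) = - (-1 : ℂ) ^ (lo + (k : ℤ)) := by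
          rw [Nat.cast_succ, ← add_assoc, zpow_add_one₀ (by norm_num)]
          ring
        rw [e₂, e₃]
        ring
    have h := tele (hi - lo).toNat
    push_cast at h₂
    rw [show lo + ((hi - lo).toNat : ℤ) = hi by omega,
      intChoose_of_lt (by simp) (show (m : ℤ) < hi - c by omega), mul_zero] at h
    simpa using h

theorem substAdd02_eq (A : ℤ → ℤ → W) (a b : ℤ) :
    substAdd02 A a b = ∑ᶠ m : ℤ, intChoose m (m - a) • A m (a + b - m) := by
  rw [← finsum_nat_eq_finsum_int a]
  · unfold substAdd02
    refine finsum_congr fun i => ?_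
    rw [show a + (i : ℤ) - a = i by ring, intChoose_natCast,
      show a + b - (a + (i : ℤ)) = b - i by ring]
  · intro m hm
    rw [intChoose_of_neg _ (by omega), zero_smul]

theorem mulAddPow_succ (k : ℕ) (X : ℤ → ℤ → W) (a b : ℤ) :
    mulAddPow (k + 1) X a b = mulAddPow k X (a - 1) b + mulAddPow k X a (b - 1) := by
  unfold mulAddPow
  rw [sum_choose_succ_smul]
  congr 1 <;> refine Finset.sum_congr rfl fun j _ => ?_ <;> congr 2 <;> push_cast <;> ring

theorem mulAddPow_eq_of_le {k l : ℕ} (hkl : k ≤ l) {X X' : ℤ → ℤ → W}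
    (h : ∀ a b, mulAddPow k X a b = mulAddPow k X' a b) (a b : ℤ) :
    mulAddPow l X a b = mulAddPow l X' a b := by
  induction hkl generalizing a b with
  | refl => exact h a b
  | step _ ih => rw [mulAddPow_succ, mulAddPow_succ, ih, ih]

theorem eq_of_mulAddPow_eq (k : ℕ) {X X' : ℤ → ℤ → W} (hX : ∀ a b, a < 0 → X a b = 0)
    (hX' : ∀ a b, a < 0 → X' a b = 0) (h : ∀ a b, mulAddPow k X a b = mulAddPow k X' a b)
    (a b : ℤ) : X a b = X' a b := by
  have key : ∀ n : ℕ, ∀ a : ℤ, a < n → ∀ b, X a b = X' a b := by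
    intro n
    induction n with
    | zero => intro a ha b; rw [hX a b (by simpa using ha), hX' a b (by simpa using ha)]
    | succ n ih =>
      intro a ha b
      have h' := h a (b + k)
      unfold mulAddPow at h'
      rw [Finset.sum_range_succ, Finset.sum_range_succ, Finset.sum_congr rfl
        (g := fun j : ℕ => ((k.choose j : ℕ) : ℂ) • X' (a - (k : ℤ) + j) (b + k - j))] at h'
      · simpa using h'
      · intro j hj
        rw [ih _ (by have := Finset.mem_range.1 hj; push_cast at ha; omega)]
  exact key (a.toNat + 1) a (by push_cast; omega) b

theorem mulAddPow_finsum (k : ℕ) (β : ℤ → ℤ → ℤ → ℂ) (β' : ℤ → ℂ) (G : ℤ → ℤ → W) (a b : ℤ)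
    (lo hi : ℤ)
    (hβ : ∀ m, ∑ j ∈ Finset.range (k + 1),
      ((k.choose j : ℕ) : ℂ) * β (a - k + j) (b - j) m = β' m)
    (h₁ : ∀ m, m < lo → ∀ j ∈ Finset.range (k + 1),
      β (a - k + j) (b - j) m • G m (a + b - k - m) = 0)
    (h₂ : ∀ m, hi < m → ∀ j ∈ Finset.range (k + 1),
      β (a - k + j) (b - j) m • G m (a + b - k - m) = 0) :
    mulAddPow k (fun a b => ∑ᶠ m, β a b m • G m (a + b - m)) a b
      = ∑ᶠ m, β' m • G m (a + b - k - m) := by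
  have e : ∀ j : ℕ, ∀ m : ℤ, a - k + j + (b - j) - m = a + b - k - m := fun j m => by ring
  have h₃ : ∀ m, (∀ j ∈ Finset.range (k + 1), β (a - k + j) (b - j) m • G m (a + b - k - m) = 0) →
      β' m • G m (a + b - k - m) = 0 := by
    intro m hm
    rw [← hβ, Finset.sum_smul]
    refine Finset.sum_eq_zero fun j hj => ?_
    rw [mul_smul, hm j hj, smul_zero]
  rw [finsum_eq_sum_Icc _ lo hi (fun m hm => h₃ m (h₁ m hm)) (fun m hm => h₃ m (h₂ m hm))]
  unfold mulAddPow
  simp only [e]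
  rw [Finset.sum_congr rfl fun j hj => by
    rw [finsum_eq_sum_Icc _ lo hi (fun m hm => h₁ m hm j hj) (fun m hm => h₂ m hm j hj)]]
  simp only [Finset.smul_sum]
  rw [Finset.sum_comm]
  refine Finset.sum_congr rfl fun m _ => ?_
  rw [← hβ, Finset.sum_smul]
  simp only [mul_smul]

theorem mulAddPow_substAdd02 (k : ℕ) (A : ℤ → ℤ → W) {N : ℤ} (hA : ∀ m n, n < N → A m n = 0)
    (a b : ℤ) :
    mulAddPow k (substAdd02 A) a b
      = ∑ᶠ m, intChoose (m + k) (m + k - a) • A m (a + b - k - m) := by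
  rw [show substAdd02 A = fun a b => ∑ᶠ m : ℤ, intChoose m (m - a) • A m (a + b - m) from
    funext fun a => funext fun b => substAdd02_eq A a b]
  refine mulAddPow_finsum k (fun a _ m => intChoose m (m - a)) _ A a b (a - k) (a + b - k - N)
    ?_ ?_ ?_
  · intro m
    rw [← sum_choose_mul_intChoose_sub]
    refine Finset.sum_congr rfl fun j _ => ?_
    congr 2
    ring
  · intro m hm j _
    rw [intChoose_of_neg _ (by omega), zero_smul]
  · intro m hm j _
    rw [hA _ _ (by omega), smul_zero]

/-- If `(x₀+x₂)^k A(x₀+x₂,x₂) = (x₀+x₂)^k C(x₀,x₂)` and `C` is regular in `x₀`, then `A` is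
truncated in `x₁` and `C(x₀,x₂) = A(x₂+x₀,x₂)`. -/
theorem regular_assoc (k : ℕ) (A C : ℤ → ℤ → W) {N : ℤ} (hA : ∀ m n, n < N → A m n = 0)
    (hC : ∀ a b, a < 0 → C a b = 0)
    (h : ∀ a b, mulAddPow k (substAdd02 A) a b = mulAddPow k C a b) :
    (∀ m n, m < -(k : ℤ) → A m n = 0) ∧
      ∀ e b, C e b = ∑ᶠ m, intChoose m e • A m (e + b - m) := by
  have hT := mulAddPow_substAdd02 k A hA
  have hk : ∀ i : ℕ, ∀ n < N + i, ∀ m, m < -(k : ℤ) → A m n = 0 := by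
    intro i
    induction i with
    | zero => intro n hn m _; exact hA m n (by simpa using hn)
    | succ i ih =>
      intro n hn m hm
      have h0 : mulAddPow k C (m + k) n = 0 :=
        Finset.sum_eq_zero fun j hj => by
          rw [hC _ _ (by have := Finset.mem_range.1 hj; omega), smul_zero]
      rw [← h, hT, finsum_eq_single _ m] at h0
      · simpa [show m + (k : ℤ) + n - k - m = n by ring] using h0
      · intro m' hm'
        rcases lt_or_gt_of_ne hm' with hlt | hgt
        · rw [intChoose_of_neg _ (by omega), zero_smul]
        · rcases lt_or_ge m' (-(k : ℤ)) with h' | h'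
          · rw [ih _ (by push_cast at hn; omega) m' h', smul_zero]
          · rw [intChoose_of_lt (by omega) (by omega), zero_smul]
  have hk' : ∀ m n, m < -(k : ℤ) → A m n = 0 := fun m n hm =>
    hk ((n - N).toNat + 1) n (by push_cast; omega) m hm
  refine ⟨hk', eq_of_mulAddPow_eq k hC (fun e b he => ?_) fun a b => ?_⟩
  · simp [intChoose_of_neg _ he]
  · rw [← h, hT, mulAddPow_finsum k (fun e _ m => intChoose m e) (fun m => intChoose (m + k) a) A a b
      (-k) (a + b - k - N)]
    · refine finsum_congr fun m => ?_
      rcases lt_or_ge m (-(k : ℤ)) with hm | hm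
      · rw [hk' m _ hm, smul_zero, smul_zero]
      · rw [intChoose_symm (by omega)]
    · intro m
      exact sum_choose_mul_intChoose_add k m a
    · intro m hm j _
      rw [hk' m _ hm, smul_zero]
    · intro m hm j _
      rw [hA _ _ (by omega), smul_zero]

/-- If `(x₀+x₂)^k A(x₀+x₂,x₂) = (x₀+x₂)^k C(x₀,x₂)` and `A` is regular in `x₂`, then
`A(x₀,0)` is determined by `C`. -/
theorem mulAddPow_substAdd02_zero (k : ℕ) (A : ℤ → ℤ → W) (hA : ∀ m n, n < 0 → A m n = 0)
    (a : ℤ) : mulAddPow k (substAdd02 A) (a + k) 0 = A a 0 := by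
  rw [mulAddPow_substAdd02 k A hA, finsum_eq_single _ a]
  · simp
  · intro m hm
    rcases lt_or_gt_of_ne hm with h | h
    · rw [intChoose_of_neg _ (by omega), zero_smul]
    · rw [hA _ _ (by omega), smul_zero]

theorem mulAddPow_zero_right (k : ℕ) (C : ℤ → ℤ → W) (hC : ∀ m n, n < 0 → C m n = 0)
    (a : ℤ) : mulAddPow k C (a + k) 0 = C a 0 := by
  unfold mulAddPow
  rw [Finset.sum_eq_single 0]
  · simp
  · intro j _ hj
    rw [hC _ _ (by omega), smul_zero]
  · simp

end Series

end FormalCalculus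

namespace NLVA

variable {K : Type*} [AddCommGroup K] [Module ℂ K] (𝒦 : NLVA K)

theorem Yc_apply (n : ℤ) (u v : K) : 𝒦.Yc n u v = 𝒦.Y u v n := rfl

theorem regular_assoc {u v : K} (h : IsPowerSeries (𝒦.Y u v)) (w : K) :
    (∃ M : ℤ, ∀ m n, m < M → 𝒦.Y u (𝒦.Y v w n) m = 0) ∧
      ∀ e b, 𝒦.Y (𝒦.Y u v e) w b
        = ∑ᶠ m, intChoose m e • 𝒦.Y u (𝒦.Y v w (e + b - m)) m := by
  obtain ⟨k, hk⟩ := 𝒦.weak_assoc u v w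
  obtain ⟨N, hN⟩ := 𝒦.trunc v w
  have := _root_.regular_assoc k (fun m n => 𝒦.Y u (𝒦.Y v w n) m)
    (fun a b => 𝒦.Y (𝒦.Y u v a) w b) (N := N) (fun m n hn => by simp [hN n hn])
    (fun a b ha => by simp [h a ha]) hk
  exact ⟨⟨-k, this.1⟩, this.2⟩

theorem Y_D (x w : K) (b : ℤ) : 𝒦.Y (𝒦.D x) w b = (b + 1 : ℂ) • 𝒦.Y x w (b + 1) := by
  have h := (𝒦.regular_assoc (𝒦.creation_reg x) w).2 1 b
  rw [finsum_eq_single _ (b + 1)] at h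
  · rw [show 𝒦.D x = 𝒦.Y x 𝒦.one 1 from rfl, h, intChoose_one, 𝒦.vacuum_left,
      if_pos (by ring)]
    push_cast
    rfl
  · intro m hm
    rw [𝒦.vacuum_left, if_neg (by omega)]
    simp

theorem Y_D_pow (x w : K) (j : ℕ) (b : ℤ) :
    𝒦.Y (((j.factorial : ℂ))⁻¹ • (𝒦.D ^ j) x) w b = intChoose (b + j) j • 𝒦.Y x w (b + j) := by
  induction j generalizing x with
  | zero => simp
  | succ j ih =>
    have h := intChoose_mul_sub (b + j) j
    have hj : ((j : ℂ) + 1) ≠ 0 := Nat.cast_add_one_ne_zero j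
    have e₁ : (((j + 1).factorial : ℂ))⁻¹ • (𝒦.D ^ (j + 1)) x
        = ((j : ℂ) + 1)⁻¹ • (((j.factorial : ℂ))⁻¹ • (𝒦.D ^ j) (𝒦.D x)) := by
      rw [smul_smul, Nat.factorial_succ, Nat.cast_mul, mul_inv, Nat.cast_succ, pow_succ,
        Module.End.mul_apply]
    have ih' := ih (𝒦.D x)
    rw [Y_D] at ih'
    rw [e₁, map_smul, LinearMap.smul_apply, Pi.smul_apply, ih', smul_smul, smul_smul]
    have e₂ : b + (j : ℤ) + 1 = b + ((j + 1 : ℕ) : ℤ) := by push_cast; ring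
    rw [← e₂]
    congr 1
    rw [intChoose_succ, Nat.cast_succ, add_sub_cancel_right, mul_assoc, inv_mul_eq_iff_eq_mul₀ hj]
    push_cast at h ⊢
    linear_combination -h

theorem Y_expD (F : ℤ → K) {N : ℤ} (hF : ∀ p, p < N → F p = 0) (w : K) (a b : ℤ) :
    𝒦.Y (expD 𝒦.D F a) w b
      = ∑ᶠ p, intChoose (a + b - p) (a - p) • 𝒦.Y (F p) w (a + b - p) := by
  have hfin : (Function.support
      fun j : ℕ => ((j.factorial : ℂ))⁻¹ • (𝒦.D ^ j) (F (a - j))).Finite := by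
    refine (Finset.range (a - N).toNat.succ).finite_toSet.subset fun j hj => ?_
    by_contra h
    refine hj ?_
    simp only [Finset.coe_range, Set.mem_Iio, not_lt] at h
    simp only
    rw [hF _ (by omega), map_zero, smul_zero]
  have h₁ : 𝒦.Y (expD 𝒦.D F a) w b = ((𝒦.Yc b).flip w) (expD 𝒦.D F a) := rfl
  rw [h₁, expD, map_finsum _ hfin, ← finsum_comp_equiv (Equiv.neg ℤ),
    ← finsum_nat_eq_finsum_int (-a)]
  · refine finsum_congr fun j => ?_
    rw [LinearMap.flip_apply, Yc_apply, Y_D_pow]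
    simp only [Equiv.neg_apply]
    rw [show a - -(-a + (j : ℤ)) = j by ring, show a + b - -(-a + (j : ℤ)) = b + j by ring,
      show -(-a + (j : ℤ)) = a - j by ring]
  · intro m hm
    simp only [Equiv.neg_apply]
    rw [intChoose_of_neg _ (by omega), zero_smul]

end NLVA

section Pairing

open TensorProduct

variable {U V K : Type*} [AddCommGroup U] [Module ℂ U] [AddCommGroup V] [Module ℂ V]
  [AddCommGroup K] [Module ℂ K]

/-- The coefficient of `x^m` in `u ⊗ v ↦ Y(u,x)v`. -/
def pairing (𝒦 : NLVA K) (jU : U →ₗ[ℂ] K) (jV : V →ₗ[ℂ] K) (m : ℤ) : U ⊗[ℂ] V →ₗ[ℂ] K :=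
  TensorProduct.lift (((𝒦.Yc m).comp jU).compl₂ jV)

/-- The coefficient of `x^n` in `u ⊗ v ↦ u ⊗ Y(v,x)v'`. -/
def rightAct (𝒱 : NLVA V) (v' : V) (n : ℤ) : U ⊗[ℂ] V →ₗ[ℂ] U ⊗[ℂ] V :=
  LinearMap.lTensor U ((𝒱.Yc n).flip v')

/-- The coefficient of `x^m` in `u' ⊗ v ↦ Y(u,x)u' ⊗ v`. -/
def leftAct (𝒰 : NLVA U) (u : U) (m : ℤ) : U ⊗[ℂ] V →ₗ[ℂ] U ⊗[ℂ] V :=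
  LinearMap.rTensor V (𝒰.Yc m u)

variable (𝒰 : NLVA U) (𝒱 : NLVA V) (𝒦 : NLVA K) (jU : U →ₗ[ℂ] K) (jV : V →ₗ[ℂ] K)

@[simp]
theorem pairing_tmul (m : ℤ) (u : U) (v : V) :
    pairing 𝒦 jU jV m (u ⊗ₜ v) = 𝒦.Y (jU u) (jV v) m := rfl

@[simp]
theorem rightAct_tmul (n : ℤ) (u : U) (v v' : V) :
    rightAct 𝒱 v' n (u ⊗ₜ[ℂ] v) = u ⊗ₜ[ℂ] 𝒱.Y v v' n := rfl

@[simp]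
theorem leftAct_tmul (n : ℤ) (u u' : U) (v : V) :
    leftAct 𝒰 u n (u' ⊗ₜ[ℂ] v) = 𝒰.Y u u' n ⊗ₜ[ℂ] v := rfl

theorem lift_Yc_map (m : ℤ) (t : U ⊗[ℂ] V) :
    TensorProduct.lift (𝒦.Yc m) (TensorProduct.map jU jV t) = pairing 𝒦 jU jV m t := by
  induction t with
  | zero => simp
  | tmul u v => rfl
  | add x y hx hy => simp only [map_add, hx, hy]

variable {𝒦 jU jV} in
theorem pairing_of_neg (hreg : ∀ u v, IsPowerSeries (𝒦.Y (jU u) (jV v))) {m : ℤ} (hm : m < 0)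
    (t : U ⊗[ℂ] V) : pairing 𝒦 jU jV m t = 0 := by
  induction t with
  | zero => simp
  | tmul u v => exact hreg u v m hm
  | add x y hx hy => rw [map_add, hx, hy, add_zero]

theorem exists_rightAct_tmul_eq_zero (v' : V) (u : U) (v : V) :
    ∃ N : ℤ, ∀ n < N, rightAct 𝒱 v' n (u ⊗ₜ[ℂ] v) = 0 := by
  obtain ⟨N, hN⟩ := 𝒱.trunc v v'
  exact ⟨N, fun n hn => by simp [hN n hn]⟩

theorem exists_leftAct_tmul_eq_zero (u u' : U) (v : V) :
    ∃ N : ℤ, ∀ n < N, leftAct 𝒰 u n (u' ⊗ₜ[ℂ] v) = 0 := by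
  obtain ⟨N, hN⟩ := 𝒰.trunc u u'
  exact ⟨N, fun n hn => by simp [hN n hn]⟩

theorem exists_trunc_of_tmul {X : Type*} [AddCommGroup X] [Module ℂ X]
    (f : ℤ → U ⊗[ℂ] V →ₗ[ℂ] X) (hf : ∀ u v, ∃ N : ℤ, ∀ n < N, f n (u ⊗ₜ v) = 0)
    (t : U ⊗[ℂ] V) : ∃ N : ℤ, ∀ n < N, f n t = 0 := by
  induction t with
  | zero => exact ⟨0, by simp⟩
  | tmul u v => exact hf u v
  | add x y hx hy =>
    obtain ⟨N₁, h₁⟩ := hx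
    obtain ⟨N₂, h₂⟩ := hy
    exact ⟨min N₁ N₂, fun n hn => by rw [map_add, h₁ n (by omega), h₂ n (by omega), add_zero]⟩

theorem IsTensorLaurent.exists_trunc {X : Type*} [AddCommGroup X] [Module ℂ X]
    {q : ℤ → U ⊗[ℂ] V} (hq : IsTensorLaurent q) (f : ℤ → U ⊗[ℂ] V →ₗ[ℂ] X)
    (hf : ∀ u v, ∃ N : ℤ, ∀ n < N, f n (u ⊗ₜ v) = 0) :
    ∃ N : ℤ, ∀ n < N, ∀ c, f n (q c) = 0 := by
  obtain ⟨-, F, ⟨S, rfl⟩, hF⟩ := hq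
  choose N hN using exists_trunc_of_tmul f hf
  obtain ⟨M, hM⟩ : ∃ M : ℤ, ∀ s ∈ S, M ≤ N s := by
    obtain ⟨M, hM⟩ := (S.finite_toSet.image N).bddBelow
    exact ⟨M, fun s hs => hM ⟨s, hs, rfl⟩⟩
  refine ⟨M, fun n hn c => ?_⟩
  have : Submodule.span ℂ (S : Set (U ⊗[ℂ] V)) ≤ LinearMap.ker (f n) :=
    Submodule.span_le.2 fun s hs => hN s n (hn.trans_le (hM s hs))
  exact this (hF c)

variable {𝒰 𝒱 𝒦 jU jV}

theorem Y_pairing (hV : NLVA.IsHom 𝒱 𝒦 jV) (hreg : ∀ u v, IsPowerSeries (𝒦.Y (jU u) (jV v)))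
    (v' : V) (e b : ℤ) (t : U ⊗[ℂ] V) :
    𝒦.Y (pairing 𝒦 jU jV e t) (jV v') b
      = ∑ᶠ m, intChoose m e • pairing 𝒦 jU jV m (rightAct 𝒱 v' (e + b - m) t) := by
  have hfin : ∀ x : U ⊗[ℂ] V, (Function.support fun m =>
      intChoose m e • pairing 𝒦 jU jV m (rightAct 𝒱 v' (e + b - m) x)).Finite := by
    intro x
    obtain ⟨N, hN⟩ := exists_trunc_of_tmul _ (exists_rightAct_tmul_eq_zero (U := U) 𝒱 v') x
    refine (Set.finite_Icc 0 (e + b - N)).subset fun m hm => ?_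
    by_contra h
    refine hm ?_
    simp only
    rw [Set.mem_Icc, not_and_or, not_le, not_le] at h
    rcases h with h | h
    · rw [pairing_of_neg hreg h, smul_zero]
    · rw [hN _ (by omega), map_zero, smul_zero]
  induction t with
  | zero => simp
  | tmul u v =>
    rw [pairing_tmul, (𝒦.regular_assoc (hreg u v) (jV v')).2]
    simp only [rightAct_tmul, pairing_tmul, hV.2]
  | add x y hx hy =>
    simp only [map_add, LinearMap.add_apply, Pi.add_apply, smul_add]
    rw [finsum_add_distrib (hfin x) (hfin y), hx, hy]

theorem Y_pairing_zero_of_left (hU : NLVA.IsHom 𝒰 𝒦 jU)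
    (hreg : ∀ u v, IsPowerSeries (𝒦.Y (jU u) (jV v))) (u : U) (n : ℤ) (t : U ⊗[ℂ] V) :
    𝒦.Y (jU u) (pairing 𝒦 jU jV 0 t) n = pairing 𝒦 jU jV 0 (leftAct 𝒰 u n t) := by
  induction t with
  | zero => simp
  | tmul u' v =>
    obtain ⟨k, hk⟩ := 𝒦.weak_assoc (jU u) (jU u') (jV v)
    have h := hk (n + k) 0
    rw [mulAddPow_substAdd02_zero k _ (fun a b hb => by rw [hreg u' v b hb]; simp),
      mulAddPow_zero_right k _ (fun a b hb => by rw [← hU.2, hreg _ v b hb])] at h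
    rw [pairing_tmul, h, leftAct_tmul, pairing_tmul, hU.2]
  | add x y hx hy => simp only [map_add, Pi.add_apply, hx, hy]

theorem Y_pairing_zero_of_right {Rop : TwistingOp 𝒰 𝒱} (hV : NLVA.IsHom 𝒱 𝒦 jV)
    (hreg : ∀ u v, IsPowerSeries (𝒦.Y (jU u) (jV v)))
    (hskew : ∀ (v : V) (u : U) (n : ℤ),
      𝒦.Y (jV v) (jU u) n
        = expD 𝒦.D (fun p => ((-1 : ℂ) ^ p) •
            ∑ᶠ c : ℤ, (TensorProduct.lift (𝒦.Yc (p - c)))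
              ((TensorProduct.map jU jV) (Rop.Rc c (v ⊗ₜ u)))) n)
    (v v' : V) (u : U) (t : ℤ) :
    𝒦.Y (jV v) (𝒦.Y (jU u) (jV v') 0) t
      = ∑ᶠ c : ℤ, (-1 : ℂ) ^ c •
          pairing 𝒦 jU jV 0 (rightAct 𝒱 v' (t - c) (Rop.Rc c (v ⊗ₜ u))) := by
  simp only [lift_Yc_map] at hskew
  set q : ℤ → U ⊗[ℂ] V := fun c => Rop.Rc c (v ⊗ₜ u) with hq
  have hqL : IsTensorLaurent q := Rop.laurent (v ⊗ₜ u)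
  obtain ⟨N₀, hN₀⟩ := hqL.1
  obtain ⟨N, hN⟩ := hqL.exists_trunc _ (exists_rightAct_tmul_eq_zero 𝒱 v')
  set F : ℤ → K := fun p => (-1 : ℂ) ^ p • ∑ᶠ c : ℤ, pairing 𝒦 jU jV (p - c) (q c) with hF
  have hF₀ : ∀ p, p < N₀ → F p = 0 := by
    intro p hp
    simp only [hF]
    rw [finsum_eq_zero_of_forall_eq_zero, smul_zero]
    intro c
    rcases lt_or_ge c N₀ with h | h
    · rw [hN₀ c h, map_zero]
    · exact pairing_of_neg hreg (by omega) _
  have hYF : ∀ p b hi, p ≤ hi → 𝒦.Y (F p) (jV v') b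
      = (-1 : ℂ) ^ p • ∑ c ∈ Finset.Icc N₀ hi, ∑ᶠ m, intChoose m (p - c) •
          pairing 𝒦 jU jV m (rightAct 𝒱 v' (p - c + b - m) (q c)) := by
    intro p b hi hp
    simp only [hF]
    rw [finsum_eq_sum_Icc _ N₀ hi (fun c hc => by rw [hN₀ c hc, map_zero])
      (fun c hc => pairing_of_neg hreg (by omega) _)]
    simp only [map_smul, map_sum, LinearMap.smul_apply, LinearMap.sum_apply, Pi.smul_apply,
      Finset.sum_apply, Y_pairing hV hreg]
  have hYF₀ : ∀ p b, b < N → 𝒦.Y (F p) (jV v') b = 0 := by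
    intro p b hb
    rw [hYF p b p le_rfl, Finset.sum_eq_zero, smul_zero]
    intro c _
    refine finsum_eq_zero_of_forall_eq_zero fun m => ?_
    rcases lt_or_ge m 0 with h | h
    · rw [pairing_of_neg hreg h, smul_zero]
    rcases lt_or_ge m (p - c) with h' | h'
    · rw [intChoose_of_lt h h', zero_smul]
    · rw [hN _ (by omega), map_zero, smul_zero]
  obtain ⟨k₀, hk₀⟩ := 𝒦.weak_assoc (jV v) (jU u) (jV v')
  obtain ⟨k, hk₀k, hkN⟩ : ∃ k : ℕ, k₀ ≤ k ∧ -(k : ℤ) ≤ N :=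
    ⟨max k₀ (-N).toNat, by omega, by omega⟩
  have hk := mulAddPow_eq_of_le hk₀k hk₀ (t + k) 0
  rw [mulAddPow_substAdd02_zero k _ (fun a b hb => by rw [hreg u v' b hb]; simp)] at hk
  rw [hk]
  have hC : (fun a b => 𝒦.Y (𝒦.Y (jV v) (jU u) a) (jV v') b) = fun a b =>
      ∑ᶠ p, intChoose (a + b - p) (a - p) • 𝒦.Y (F p) (jV v') (a + b - p) := by
    funext a b
    rw [hskew, 𝒦.Y_expD F hF₀]
  rw [hC, mulAddPow_finsum k (fun a b p => intChoose (a + b - p) (a - p))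
    (fun p => intChoose (t + k - p) (t + k - p)) (fun p b => 𝒦.Y (F p) (jV v') b) (t + k) 0
    N₀ (t + k)]
  rotate_left
  · intro p
    have h := sum_choose_mul_intChoose_add k (t - p) (t + k - p)
    rw [show t - p + (k : ℤ) = t + k - p by ring] at h
    rw [← h]
    refine Finset.sum_congr rfl fun j _ => ?_
    congr 2 <;> ring
  · intro p hp j _
    rw [hF₀ p hp]
    simp
  · intro p hp j hj
    have := Finset.mem_range.1 hj
    rw [intChoose_of_neg _ (by omega), zero_smul]
  have hG : ∀ p, intChoose (t + k - p) (t + k - p) • 𝒦.Y (F p) (jV v') (t + k + 0 - k - p)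
      = 𝒦.Y (F p) (jV v') (t - p) := by
    intro p
    rw [show t + (k : ℤ) + 0 - k - p = t - p by ring]
    rcases lt_or_ge (t + k) p with h | h
    · rw [hYF₀ p _ (by omega), smul_zero]
    · rw [← intChoose_symm (by omega), sub_self, intChoose_zero, one_smul]
  rw [finsum_congr hG, finsum_eq_sum_Icc _ N₀ (t - N) (fun p hp => by rw [hF₀ p hp]; simp)
    (fun p hp => hYF₀ p _ (by omega))]
  have hB : ∀ c ∈ Finset.Icc N₀ (t - N), ∀ m, 0 ≤ m → t - N < c + m →
      rightAct 𝒱 v' (t - c - m) (q c) = 0 := fun c _ m _ h => hN _ (by omega) c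
  have hsum : ∀ p ∈ Finset.Icc N₀ (t - N), 𝒦.Y (F p) (jV v') (t - p)
      = ∑ c ∈ Finset.Icc N₀ (t - N), ∑ m ∈ Finset.Icc 0 (t - N - N₀),
        ((-1 : ℂ) ^ p * intChoose m (p - c)) •
          pairing 𝒦 jU jV m (rightAct 𝒱 v' (t - c - m) (q c)) := by
    intro p hp
    rw [hYF p _ (t - N) (Finset.mem_Icc.1 hp).2, Finset.smul_sum]
    refine Finset.sum_congr rfl fun c hc => ?_
    rw [finsum_eq_sum_Icc _ 0 (t - N - N₀), Finset.smul_sum]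
    · refine Finset.sum_congr rfl fun m _ => ?_
      rw [mul_smul, show p - c + (t - p) - m = t - c - m by ring]
    · intro m hm
      rw [pairing_of_neg hreg hm, smul_zero]
    · intro m hm
      have := Finset.mem_Icc.1 hc
      rw [hN _ (by omega), map_zero, smul_zero]
  rw [Finset.sum_congr rfl hsum, Finset.sum_comm,
    finsum_eq_sum_Icc _ N₀ (t - N) (fun c hc => by rw [show Rop.Rc c (v ⊗ₜ u) = 0 from hN₀ c hc]; simp)
      (fun c hc => by rw [hN _ (by omega)]; simp)]
  refine Finset.sum_congr rfl fun c hc => ?_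
  have hc' := Finset.mem_Icc.1 hc
  rw [Finset.sum_comm]
  simp only [← Finset.sum_smul]
  have hm : ∀ m ∈ Finset.Icc 0 (t - N - N₀),
      (∑ p ∈ Finset.Icc N₀ (t - N), (-1 : ℂ) ^ p * intChoose m (p - c)) •
        pairing 𝒦 jU jV m (rightAct 𝒱 v' (t - c - m) (q c))
      = if m = 0 then (-1 : ℂ) ^ c • pairing 𝒦 jU jV 0 (rightAct 𝒱 v' (t - c) (q c)) else 0 := by
    intro m hm
    have hm' := (Finset.mem_Icc.1 hm).1
    lift m to ℕ using hm'
    rcases lt_or_ge (t - N) (c + m) with h | h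
    · rw [hB c hc m (by simp) h, map_zero, smul_zero, if_neg (by omega)]
    · rw [sum_neg_one_zpow_mul_intChoose m hc'.1 h]
      by_cases h0 : m = 0
      · simp [h0]
      · simp [h0]
  rw [Finset.sum_congr rfl hm, Finset.sum_ite_eq', if_pos (Finset.mem_Icc.2 ⟨le_rfl, by omega⟩)]

end Pairing

section Homomorphism

open TensorProduct

variable {U V K : Type*} [AddCommGroup U] [Module ℂ U] [AddCommGroup V] [Module ℂ V]
  [AddCommGroup K] [Module ℂ K]
  {𝒰 : NLVA U} {𝒱 : NLVA V} {𝒦 : NLVA K} {jU : U →ₗ[ℂ] K} {jV : V →ₗ[ℂ] K}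

theorem map_Yc_flip (u : U) (v' : V) (a n : ℤ) (t : U ⊗[ℂ] V) :
    TensorProduct.map (𝒰.Yc a u) ((𝒱.Yc n).flip v') t = leftAct 𝒰 u a (rightAct 𝒱 v' n t) := by
  induction t with
  | zero => simp
  | tmul x y => rfl
  | add x y hx hy => simp only [map_add, hx, hy]

theorem rightAct_leftAct (u : U) (v' : V) (a n : ℤ) (t : U ⊗[ℂ] V) :
    rightAct 𝒱 v' n (leftAct 𝒰 u a t) = leftAct 𝒰 u a (rightAct 𝒱 v' n t) := by
  induction t with
  | zero => simp
  | tmul x y => rfl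
  | add x y hx hy => simp only [map_add, hx, hy]

theorem pairing_YRcoef {Rop : TwistingOp 𝒰 𝒱} (hU : NLVA.IsHom 𝒰 𝒦 jU)
    (hV : NLVA.IsHom 𝒱 𝒦 jV) (hreg : ∀ u v, IsPowerSeries (𝒦.Y (jU u) (jV v)))
    (hskew : ∀ (v : V) (u : U) (n : ℤ),
      𝒦.Y (jV v) (jU u) n
        = expD 𝒦.D (fun p => ((-1 : ℂ) ^ p) •
            ∑ᶠ c : ℤ, (TensorProduct.lift (𝒦.Yc (p - c)))
              ((TensorProduct.map jU jV) (Rop.Rc c (v ⊗ₜ u)))) n)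
    (u u' : U) (v v' : V) (n : ℤ) :
    pairing 𝒦 jU jV 0 (YRcoef 𝒰 𝒱 Rop u v u' v' n)
      = 𝒦.Y (pairing 𝒦 jU jV 0 (u ⊗ₜ v)) (pairing 𝒦 jU jV 0 (u' ⊗ₜ v')) n := by
  unfold YRcoef
  set q : ℤ → U ⊗[ℂ] V := fun c => Rop.Rc c (v ⊗ₜ u') with hq
  have hqL : IsTensorLaurent q := Rop.laurent (v ⊗ₜ u')
  obtain ⟨N₀, hN₀⟩ := hqL.1
  obtain ⟨N, hN⟩ := hqL.exists_trunc _ (exists_rightAct_tmul_eq_zero 𝒱 v')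
  obtain ⟨M, hM⟩ := hqL.exists_trunc _ (exists_leftAct_tmul_eq_zero 𝒰 u)
  have hM' : ∀ a < M, ∀ s c, leftAct 𝒰 u a (rightAct 𝒱 v' s (q c)) = 0 := fun a ha s c => by
    rw [← rightAct_leftAct, hM a ha, map_zero]
  have hw : ∀ s hi, s - N ≤ hi → 𝒦.Y (jV v) (pairing 𝒦 jU jV 0 (u' ⊗ₜ v')) s
      = ∑ c ∈ Finset.Icc N₀ hi, (-1 : ℂ) ^ c •
          pairing 𝒦 jU jV 0 (rightAct 𝒱 v' (s - c) (q c)) := by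
    intro s hi hs
    rw [pairing_tmul, Y_pairing_zero_of_right hV hreg hskew, finsum_eq_sum_Icc _ N₀ hi]
    · intro c hc
      rw [show Rop.Rc c (v ⊗ₜ u') = 0 from hN₀ c hc]
      simp
    · intro c hc
      rw [hN _ (by omega)]
      simp
  have hL : ∀ c a, ((-1 : ℂ) ^ c) • (TensorProduct.map (𝒰.Yc a u) ((𝒱.Yc (n - c - a)).flip v'))
      (Rop.Rc c (v ⊗ₜ u')) = (-1 : ℂ) ^ c • leftAct 𝒰 u a (rightAct 𝒱 v' (n - c - a) (q c)) :=
    fun c a => by rw [map_Yc_flip]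
  simp only [hL]
  rw [pairing_tmul, (𝒦.regular_assoc (hreg u v) _).2,
    finsum_eq_sum_Icc _ N₀ (n - N - M), finsum_eq_sum_Icc _ M (n - N - N₀)]
  · have hinner : ∀ c ∈ Finset.Icc N₀ (n - N - M),
        ∑ᶠ a, (-1 : ℂ) ^ c • leftAct 𝒰 u a (rightAct 𝒱 v' (n - c - a) (q c))
        = ∑ a ∈ Finset.Icc M (n - N - N₀),
          (-1 : ℂ) ^ c • leftAct 𝒰 u a (rightAct 𝒱 v' (n - c - a) (q c)) := by
      intro c hc
      have := Finset.mem_Icc.1 hc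
      refine finsum_eq_sum_Icc _ _ _ (fun a ha => ?_) (fun a ha => ?_)
      · rw [hM' a ha, smul_zero]
      · rw [hN _ (by omega), map_zero, smul_zero]
    rw [Finset.sum_congr rfl hinner, Finset.sum_comm]
    simp only [map_sum]
    refine Finset.sum_congr rfl fun a ha => ?_
    have := Finset.mem_Icc.1 ha
    rw [hw _ (n - N - M) (by omega)]
    simp only [intChoose_zero, one_smul, map_sum, Finset.sum_apply, map_smul, Pi.smul_apply]
    refine Finset.sum_congr rfl fun c _ => ?_
    rw [Y_pairing_zero_of_left hU hreg, show n - c - a = 0 + n - a - c by ring]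
  · intro a ha
    rw [hw _ _ le_rfl]
    simp only [map_sum, Finset.sum_apply, map_smul, Pi.smul_apply]
    rw [Finset.sum_eq_zero, smul_zero]
    intro c _
    rw [Y_pairing_zero_of_left hU hreg, hM' a ha, map_zero, smul_zero]
  · intro a ha
    rw [hw _ _ le_rfl, Finset.Icc_eq_empty (by omega)]
    simp
  · intro c hc
    refine finsum_eq_zero_of_forall_eq_zero fun a => ?_
    rw [hN₀ c hc]
    simp
  · intro c hc
    refine finsum_eq_zero_of_forall_eq_zero fun a => ?_
    rcases lt_or_ge a M with h | h
    · rw [hM' a h, smul_zero]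
    · rw [hN _ (by omega), map_zero, smul_zero]

theorem isHom_pairing {Rop : TwistingOp 𝒰 𝒱} {𝒯 : NLVA (U ⊗[ℂ] V)}
    (h𝒯 : IsTwistedTensor 𝒰 𝒱 Rop 𝒯) (hU : NLVA.IsHom 𝒰 𝒦 jU)
    (hV : NLVA.IsHom 𝒱 𝒦 jV) (hreg : ∀ u v, IsPowerSeries (𝒦.Y (jU u) (jV v)))
    (hskew : ∀ (v : V) (u : U) (n : ℤ),
      𝒦.Y (jV v) (jU u) n
        = expD 𝒦.D (fun p => ((-1 : ℂ) ^ p) •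
            ∑ᶠ c : ℤ, (TensorProduct.lift (𝒦.Yc (p - c)))
              ((TensorProduct.map jU jV) (Rop.Rc c (v ⊗ₜ u)))) n) :
    NLVA.IsHom 𝒯 𝒦 (pairing 𝒦 jU jV 0) := by
  refine ⟨?_, fun s t n => ?_⟩
  · rw [h𝒯.1, pairing_tmul, hU.1, 𝒦.vacuum_left, if_pos rfl, hV.1]
  · induction s with
    | zero => simp
    | add x y hx hy => simp only [map_add, LinearMap.add_apply, Pi.add_apply, hx, hy]
    | tmul u v =>
      induction t with
      | zero => simp
      | add x y hx hy => simp only [map_add, Pi.add_apply, hx, hy]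
      | tmul u' v' => rw [h𝒯.2, pairing_YRcoef hU hV hreg hskew]

theorem NLVA.IsHom.surjective_of_isGeneratedBy {T : Type*} [AddCommGroup T] [Module ℂ T]
    {𝒯 : NLVA T} {f : T →ₗ[ℂ] K} (hf : NLVA.IsHom 𝒯 𝒦 f) {S : Set K} (hS : S ⊆ Set.range f)
    (hgen : NLVA.IsGeneratedBy 𝒦 S) : Function.Surjective f := by
  rw [← LinearMap.range_eq_top]
  refine hgen _ ⟨𝒯.one, hf.1⟩ ?_ hS
  rintro _ ⟨a, rfl⟩ _ ⟨b, rfl⟩ n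
  exact ⟨𝒯.Y a b n, hf.2 a b n⟩

end Homomorphism

section Schur

open Polynomial

variable {U : Type*} [AddCommGroup U] [Module ℂ U]

theorem Module.End.aeval_injective_of_forall_sub_injective (d : Module.End ℂ U)
    (hd : ∀ a : ℂ, Function.Injective (d - algebraMap ℂ (Module.End ℂ U) a))
    {p : ℂ[X]} (hp : p ≠ 0) : Function.Injective (aeval d p) := by
  have hs : ∀ s : Multiset ℂ,
      Function.Injective (aeval d (s.map fun a => X - C a).prod) := by
    intro s
    induction s using Multiset.induction_on with
    | empty =>
      intro x y hxy
      simpa using hxy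
    | cons a s ih =>
      rw [Multiset.map_cons, Multiset.prod_cons, map_mul, Module.End.mul_eq_comp,
        LinearMap.coe_comp]
      refine Function.Injective.comp ?_ ih
      rw [map_sub, aeval_X, aeval_C]
      exact hd a
  rw [(IsAlgClosed.splits p).eq_prod_roots, map_mul, aeval_C, Module.End.mul_eq_comp,
    LinearMap.coe_comp]
  refine Function.Injective.comp ?_ (hs _)
  intro x y hxy
  exact smul_right_injective U (leadingCoeff_ne_zero.2 hp) hxy

/-- A Schur lemma for countable-dimensional spaces: an endomorphism all of whose translates by
scalars are bijective cannot exist. -/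
theorem CountableDim.exists_not_bijective_sub [Nontrivial U] (hU : CountableDim U)
    (d : Module.End ℂ U) :
    ∃ a : ℂ, ¬ Function.Bijective (d - algebraMap ℂ (Module.End ℂ U) a) := by
  by_contra! hd
  obtain ⟨x, hx⟩ := exists_ne (0 : U)
  choose g hg using fun a : ℂ => (hd a).2 x
  have hli : LinearIndependent ℂ g := by
    classical
    refine linearIndependent_iff'.2 fun s m hm i hi => ?_
    let p : ℂ[X] := s.sum fun i => C (m i) * (s.erase i).prod fun j => X - C j
    have hpx : aeval d p x = 0 := by
      have h := congrArg (aeval d (∏ j ∈ s, (X - C j))) hm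
      rw [map_zero, map_sum] at h
      rw [← h]
      simp only [p, map_sum, LinearMap.sum_apply]
      refine Finset.sum_congr rfl fun j hj => ?_
      rw [← Finset.prod_erase_mul s _ hj, map_mul, map_mul, Module.End.mul_apply,
        Module.End.mul_apply, map_smul, map_sub, aeval_X, aeval_C, aeval_C, hg, map_smul]
      rfl
    have hp : p = 0 := by
      by_contra hp
      exact hx (Module.End.aeval_injective_of_forall_sub_injective d (fun a => (hd a).1) hp
        (hpx.trans (map_zero _).symm))
    have h := congrArg (eval i) hp
    simp only [p, eval_finsetSum, eval_mul, eval_C, eval_prod, eval_sub, eval_X, eval_zero] at h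
    rw [Finset.sum_eq_single i] at h
    · exact (mul_eq_zero.1 h).resolve_right (Finset.prod_ne_zero_iff.2 fun j hj =>
        sub_ne_zero.2 (Finset.ne_of_mem_erase hj).symm)
    · intro j hj hji
      rw [Finset.prod_eq_zero (Finset.mem_erase.2 ⟨hji.symm, hi⟩) (sub_self i), mul_zero]
    · exact fun h => absurd hi h
  obtain ⟨s, hs, hspan⟩ := hU
  have h₁ := hli.cardinal_lift_le_rank
  have h₂ : Module.rank ℂ U ≤ Cardinal.aleph0 := by
    rw [← rank_top, ← hspan]
    exact (rank_span_le s).trans (Cardinal.mk_le_aleph0_iff.2 hs.to_subtype)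
  have h₃ := h₁.trans (Cardinal.lift_le_aleph0.2 h₂)
  rw [Cardinal.lift_le_aleph0, Cardinal.mk_complex] at h₃
  exact absurd h₃ Cardinal.aleph0_lt_continuum.not_ge

end Schur

section Density

open TensorProduct

variable {U V K : Type*} [AddCommGroup U] [Module ℂ U] [AddCommGroup V] [Module ℂ V]
  [AddCommGroup K] [Module ℂ K]

/-- The associative algebra of endomorphisms generated by the modes of `𝒰`. -/
def modeAlgebra (𝒰 : NLVA U) : Subalgebra ℂ (Module.End ℂ U) :=
  Algebra.adjoin ℂ (Set.range fun i : ℤ × U => 𝒰.Yc i.1 i.2)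

theorem Yc_mem_modeAlgebra (𝒰 : NLVA U) (m : ℤ) (u : U) : 𝒰.Yc m u ∈ modeAlgebra 𝒰 :=
  Algebra.subset_adjoin ⟨(m, u), rfl⟩

theorem NLVA.SelfIrreducible.isSimpleModule {𝒰 : NLVA U} (hirr : 𝒰.SelfIrreducible) :
    IsSimpleModule (modeAlgebra 𝒰) U := by
  have := hirr.1
  rw [isSimpleModule_iff]
  refine { eq_bot_or_eq_top := fun P => ?_ }
  have h := hirr.2 (P.restrictScalars ℂ) fun u p hp n =>
    P.smul_mem (⟨𝒰.Yc n u, Yc_mem_modeAlgebra 𝒰 n u⟩ : modeAlgebra 𝒰) hp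
  simpa only [Submodule.restrictScalars_eq_bot_iff, Submodule.restrictScalars_eq_top_iff] using h

theorem NLVA.SelfIrreducible.exists_smul_eq {𝒰 : NLVA U} (hirr : 𝒰.SelfIrreducible)
    (hcd : CountableDim U) (d : Module.End (modeAlgebra 𝒰) U) :
    ∃ a : ℂ, ∀ x, d x = a • x := by
  have := hirr.1
  have := hirr.isSimpleModule
  obtain ⟨a, ha⟩ := hcd.exists_not_bijective_sub (d.restrictScalars ℂ)
  refine ⟨a, fun x => ?_⟩
  have h := (LinearMap.bijective_or_eq_zero
    (d - algebraMap ℂ (Module.End (modeAlgebra 𝒰) U) a)).resolve_left ha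
  exact sub_eq_zero.1 (LinearMap.congr_fun h x)

theorem NLVA.SelfIrreducible.exists_modeAlgebra_eq {𝒰 : NLVA U} (hirr : 𝒰.SelfIrreducible)
    (hcd : CountableDim U) (f : Module.End ℂ U) (s : Finset U) :
    ∃ r ∈ modeAlgebra 𝒰, ∀ x ∈ s, f x = r x := by
  have := hirr.isSimpleModule
  let f' : Module.End (Module.End (modeAlgebra 𝒰) U) U :=
    { f with
      map_smul' := fun d x => by
        obtain ⟨a, ha⟩ := hirr.exists_smul_eq hcd d
        change f (d x) = d (f x)
        rw [ha, ha, map_smul] }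
  obtain ⟨r, hr⟩ := jacobson_density f' s
  exact ⟨r, r.2, hr⟩

variable {𝒰 : NLVA U} {𝒱 : NLVA V} {𝒦 : NLVA K} {jU : U →ₗ[ℂ] K} {jV : V →ₗ[ℂ] K}

theorem pairing_rTensor_eq_zero (hU : NLVA.IsHom 𝒰 𝒦 jU)
    (hreg : ∀ u v, IsPowerSeries (𝒦.Y (jU u) (jV v))) {r : Module.End ℂ U}
    (hr : r ∈ modeAlgebra 𝒰) {p : U ⊗[ℂ] V} (hp : pairing 𝒦 jU jV 0 p = 0) :
    pairing 𝒦 jU jV 0 (r.rTensor V p) = 0 := by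
  induction hr using Algebra.adjoin_induction generalizing p with
  | mem r hr =>
    obtain ⟨⟨m, u⟩, rfl⟩ := hr
    have h := Y_pairing_zero_of_left hU hreg u m p
    rw [hp] at h
    rw [map_zero, Pi.zero_apply] at h
    exact h.symm
  | algebraMap a =>
    rw [Algebra.algebraMap_eq_smul_one, LinearMap.rTensor_smul, LinearMap.smul_apply, map_smul,
      Module.End.one_eq_id, LinearMap.rTensor_id, LinearMap.id_apply, hp, smul_zero]
  | add x y _ _ hx hy => rw [LinearMap.rTensor_add, LinearMap.add_apply, map_add, hx hp, hy hp,
      add_zero]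
  | mul x y _ _ hx hy => rw [LinearMap.rTensor_mul, Module.End.mul_apply, hx (hy hp)]

theorem exists_finset_rTensor_congr (p : U ⊗[ℂ] V) :
    ∃ s : Finset U, ∀ f g : Module.End ℂ U, (∀ x ∈ s, f x = g x) →
      f.rTensor V p = g.rTensor V p := by
  classical
  induction p with
  | zero => exact ⟨∅, fun f g _ => by simp⟩
  | tmul u v => exact ⟨{u}, fun f g h => by simp [h u]⟩
  | add x y hx hy =>
    obtain ⟨s, hs⟩ := hx
    obtain ⟨t, ht⟩ := hy
    refine ⟨s ∪ t, fun f g h => ?_⟩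
    rw [map_add, map_add, hs f g fun x hx => h x (Finset.mem_union_left _ hx),
      ht f g fun x hx => h x (Finset.mem_union_right _ hx)]

theorem pairing_injective (hU : NLVA.IsHom 𝒰 𝒦 jU) (hVinj : Function.Injective jV)
    (hreg : ∀ u v, IsPowerSeries (𝒦.Y (jU u) (jV v)))
    (hirr : 𝒰.SelfIrreducible) (hcd : CountableDim U) :
    Function.Injective (pairing 𝒦 jU jV 0) := by
  classical
  rw [injective_iff_map_eq_zero]
  intro p hp
  obtain ⟨s, hs⟩ := exists_finset_rTensor_congr p
  let ℬ := Module.Basis.ofVectorSpace ℂ U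
  refine (TensorProduct.equivFinsuppOfBasisLeft ℬ).map_eq_zero_iff.1 (Finsupp.ext fun i => ?_)
  obtain ⟨r, hr, hrs⟩ := hirr.exists_modeAlgebra_eq hcd ((ℬ.coord i).smulRight 𝒰.one) s
  have h := pairing_rTensor_eq_zero hU hreg hr hp
  rw [← hs _ _ hrs] at h
  have key : ∀ q : U ⊗[ℂ] V, pairing 𝒦 jU jV 0 (((ℬ.coord i).smulRight 𝒰.one).rTensor V q)
      = jV (TensorProduct.equivFinsuppOfBasisLeft ℬ q i) := by
    intro q
    induction q with
    | zero => simp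
    | tmul u v =>
      rw [LinearMap.rTensor_tmul, pairing_tmul, LinearMap.smulRight_apply, map_smul, map_smul,
        hU.1, LinearMap.smul_apply, Pi.smul_apply, 𝒦.vacuum_left, if_pos rfl,
        TensorProduct.equivFinsuppOfBasisLeft_apply_tmul_apply, map_smul, Module.Basis.coord_apply]
    | add x y hx hy => simp only [map_add, Finsupp.add_apply, hx, hy]
  rw [key] at h
  exact (injective_iff_map_eq_zero jV).1 hVinj _ h

theorem range_union_range_subset_range_pairing (hU : NLVA.IsHom 𝒰 𝒦 jU)
    (hV : NLVA.IsHom 𝒱 𝒦 jV) :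
    Set.range jU ∪ Set.range jV ⊆ Set.range (pairing 𝒦 jU jV 0) := by
  rintro _ (⟨u, rfl⟩ | ⟨v, rfl⟩)
  · exact ⟨u ⊗ₜ 𝒱.one, by rw [pairing_tmul, hV.1, 𝒦.creation_zero]⟩
  · exact ⟨𝒰.one ⊗ₜ v, by rw [pairing_tmul, hU.1, 𝒦.vacuum_left, if_pos rfl]⟩

end Density

/-- Characterization of the twisted tensor product (Proposition 2.8):
if `K` contains `U` and `V` as subalgebras with the given compatibility relations,
is generated by `U ∪ V`, and `U` is an irreducible `U`-module of countable
dimension, then `θ(u⊗v) = u_{-1}v` is an isomorphism `U ⊗_R V → K`. -/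
theorem statement_6 {U V K : Type*} [AddCommGroup U] [Module ℂ U]
    [AddCommGroup V] [Module ℂ V] [AddCommGroup K] [Module ℂ K]
    (𝒰 : NLVA U) (𝒱 : NLVA V) (Rop : TwistingOp 𝒰 𝒱)
    (𝒯 : NLVA (U ⊗[ℂ] V)) (h𝒯 : IsTwistedTensor 𝒰 𝒱 Rop 𝒯)
    (𝒦 : NLVA K) (jU : U →ₗ[ℂ] K) (jV : V →ₗ[ℂ] K)
    (hU : NLVA.IsHom 𝒰 𝒦 jU) (hUinj : Function.Injective jU)
    (hV : NLVA.IsHom 𝒱 𝒦 jV) (hVinj : Function.Injective jV)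
    (hreg : ∀ (u : U) (v : V), IsPowerSeries (𝒦.Y (jU u) (jV v)))
    (hskew : ∀ (v : V) (u : U) (n : ℤ),
      𝒦.Y (jV v) (jU u) n
        = expD 𝒦.D (fun p => ((-1 : ℂ) ^ p) •
            ∑ᶠ c : ℤ, (TensorProduct.lift (𝒦.Yc (p - c)))
              ((TensorProduct.map jU jV) (Rop.Rc c (v ⊗ₜ u)))) n)
    (hgen : NLVA.IsGeneratedBy 𝒦 (Set.range jU ∪ Set.range jV))
    (hirr : NLVA.SelfIrreducible 𝒰) (hcd : CountableDim U) :
    NLVA.IsHom 𝒯 𝒦 (TensorProduct.lift (((𝒦.Yc 0).comp jU).compl₂ jV)) ∧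
    Function.Bijective (TensorProduct.lift (((𝒦.Yc 0).comp jU).compl₂ jV)) := by
  change NLVA.IsHom 𝒯 𝒦 (pairing 𝒦 jU jV 0) ∧ Function.Bijective (pairing 𝒦 jU jV 0)
  have hhom := isHom_pairing h𝒯 hU hV hreg hskew
  exact ⟨hhom, pairing_injective hU hVinj hreg hirr hcd,
    hhom.surjective_of_isGeneratedBy (range_union_range_subset_range_pairing hU hV) hgen⟩
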